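/- arXiv:math/9903025 — 2 statements merged into one kernel-verified Lean document; each statement's English description precedes it below -/
import Mathlib

section
/- The number of spanning trees of the ℓ × m grid graph equals (1/(ℓm)) · ∏ [4 − 2cos(πj/ℓ) − 2cos(πk/m)], where the product is over all pairs (j,k) with 0 ≤ j ≤ ℓ−1, 0 ≤ k ≤ m−1, excluding (j,k) = (0,0). -/
/-- The `ℓ × m` grid graph: vertices `{0,…,ℓ-1} × {0,…,m-1}`, with edges between
points at Euclidean distance 1. -/
def gridGraph (ℓ m : ℕ) : SimpleGraph (Fin ℓ × Fin m) :=
  SimpleGraph.fromRel (fun a b =>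
    (a.1 = b.1 ∧ (a.2 : ℕ) + 1 = b.2) ∨ (a.2 = b.2 ∧ (a.1 : ℕ) + 1 = b.1))

namespace SimpleGraph

variable {V : Type*}

/-- The graph joining every vertex `v` to its parent `f v`. -/
def parentGraph (f : V → V) : SimpleGraph V :=
  fromRel fun v w => f v = w

theorem parentGraph_adj {f : V → V} {v w : V} :
    (parentGraph f).Adj v w ↔ v ≠ w ∧ (f v = w ∨ f w = v) := by
  simp [parentGraph]

theorem parentGraph_reachable_iterate (f : V → V) (v : V) (k : ℕ) :
    (parentGraph f).Reachable v (f^[k] v) := by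
  induction k with
  | zero => exact Reachable.refl _
  | succ k ih =>
    rw [Function.iterate_succ_apply']
    refine ih.trans ?_
    by_cases h : f^[k] v = f (f^[k] v)
    · rw [← h]
    · exact (parentGraph_adj.2 ⟨h, Or.inl rfl⟩).reachable

theorem parentGraph_isTree [Finite V] {f : V → V} {r : V} (hr : f r = r)
    (hf : ∀ v, ∃ k, f^[k] v = r) : (parentGraph f).IsTree := by
  classical
  have := Fintype.ofFinite V
  have hconn : (parentGraph f).Connected := by
    have h (v : V) : (parentGraph f).Reachable v r := by
      obtain ⟨k, hk⟩ := hf v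
      exact hk ▸ parentGraph_reachable_iterate f v k
    exact { preconnected := fun u v => (h u).trans (h v).symm, nonempty := ⟨r⟩ }
  refine isTree_iff_connected_and_card.2 ⟨hconn,
    le_antisymm ?_ hconn.card_vert_le_card_edgeSet_add_one⟩
  have hsub : (parentGraph f).edgeSet ⊆ (Finset.univ.erase r).image fun v => s(v, f v) := by
    intro e
    induction e using Sym2.ind with
    | _ v w =>
      intro h
      obtain ⟨hne, h | h⟩ := parentGraph_adj.1 h
      · exact Finset.mem_coe.2 (Finset.mem_image.2
          ⟨v, Finset.mem_erase.2 ⟨by grind, Finset.mem_univ _⟩, by rw [h]⟩)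
      · exact Finset.mem_coe.2 (Finset.mem_image.2
          ⟨w, Finset.mem_erase.2 ⟨by grind, Finset.mem_univ _⟩, by rw [h, Sym2.eq_swap]⟩)
  have hle := (Set.ncard_le_ncard hsub (Finset.finite_toSet _)).trans
    ((Set.ncard_coe_finset _).trans_le Finset.card_image_le)
  rw [Finset.card_erase_of_mem (Finset.mem_univ r), Finset.card_univ] at hle
  have hpos : 0 < Fintype.card V := Fintype.card_pos_iff.2 ⟨r⟩
  rw [Nat.card_eq_fintype_card (α := V), Nat.card_coe_set_eq]
  omega

theorem eq_of_parentGraph_eq {f g : V → V} {r : V} (hf : f r = r) (hg : g r = r)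
    (hreach : ∀ v, ∃ k, g^[k] v = r) (h : parentGraph f = parentGraph g) : f = g := by
  have edge (v : V) (hv : g v ≠ v) : f v = g v ∨ f (g v) = v := by
    have hadj : (parentGraph f).Adj v (g v) := h ▸ parentGraph_adj.2 ⟨hv.symm, Or.inl rfl⟩
    exact (parentGraph_adj.1 hadj).2
  have fixed (v : V) (hv : g v = v) : v = r := by
    obtain ⟨k, hk⟩ := hreach v
    rwa [Function.iterate_fixed hv] at hk
  have two_cycle (v : V) (hv : g (g v) = v) : v = r := by
    obtain ⟨k, hk⟩ := hreach v
    have hmem (k : ℕ) : g^[k] v = v ∨ g^[k] v = g v := by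
      induction k with
      | zero => exact Or.inl rfl
      | succ k ih =>
        rw [Function.iterate_succ_apply']
        rcases ih with ih | ih <;> simp [ih, hv]
    rcases hmem k with h | h
    · exact h.symm.trans hk
    · rw [← hv, ← h, hk, hg]
  have back (k : ℕ) : ∀ v, g^[k] v = r → f (g v) = v → v = r := by
    induction k with
    | zero => exact fun v hv _ => hv
    | succ k ih =>
      intro v hv hfv
      by_cases hb : g (g v) = g v
      · have := fixed _ hb
        rw [this, hf] at hfv
        exact hfv.symm
      rcases edge (g v) hb with h1 | h1
      · exact two_cycle v (h1.symm.trans hfv)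
      · have := ih (g v) hv h1
        rw [this, hf] at hfv
        exact hfv.symm
  funext v
  by_cases hv : g v = v
  · rw [fixed v hv, hf, hg]
  rcases edge v hv with h1 | h1
  · exact h1
  · obtain ⟨k, hk⟩ := hreach v
    rw [back k v hk h1, hf, hg]

theorem Connected.exists_adj_dist_add_one_eq {G : SimpleGraph V} (hG : G.Connected) {r v : V}
    (hv : v ≠ r) : ∃ w, G.Adj v w ∧ G.dist w r + 1 = G.dist v r := by
  obtain ⟨p, hp⟩ := hG.exists_walk_length_eq_dist v r
  cases p with
  | nil => exact absurd rfl hv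
  | @cons _ w _ hadj q =>
    refine ⟨w, hadj, ?_⟩
    rw [Walk.length_cons] at hp
    have h1 := dist_le q
    have h2 := hG.dist_triangle (u := v) (v := w) (w := r)
    rw [dist_eq_one_iff_adj.2 hadj] at h2
    omega

theorem IsTree.exists_parentGraph_eq [Finite V] {H : SimpleGraph V} (hH : H.IsTree) (r : V) :
    ∃ f : V → V, f r = r ∧ (∀ v, v ≠ r → H.Adj v (f v)) ∧ (∀ v, ∃ k, f^[k] v = r) ∧
      parentGraph f = H := by
  classical
  choose! p hadj hdist using
    fun (v : V) (hv : v ≠ r) => hH.connected.exists_adj_dist_add_one_eq hv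
  set f : V → V := fun v => if v = r then r else p v with hf
  have hfr : f r = r := by simp [hf]
  have hfv (v : V) (hv : v ≠ r) : f v = p v := by simp [hf, hv]
  have hreach : ∀ (k : ℕ) (v : V), H.dist v r = k → ∃ k, f^[k] v = r := by
    intro k
    induction k with
    | zero => exact fun v hv => ⟨0, hH.connected.dist_eq_zero_iff.1 hv⟩
    | succ k ih =>
      intro v hv
      have hne : v ≠ r := by
        rintro rfl
        simp at hv
      obtain ⟨j, hj⟩ := ih (p v) (by have := hdist v hne; omega)
      exact ⟨j + 1, by rw [Function.iterate_succ_apply, hfv v hne, hj]⟩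
  have hreach' (v : V) : ∃ k, f^[k] v = r := hreach _ v rfl
  have hadj' (v : V) (hv : v ≠ r) : H.Adj v (f v) := by
    rw [hfv v hv]
    exact hadj v hv
  refine ⟨f, hfr, hadj', hreach', ?_⟩
  have hle : parentGraph f ≤ H := by
    intro v w hvw
    obtain ⟨hne, h | h⟩ := parentGraph_adj.1 hvw
    · exact h ▸ hadj' v (by grind)
    · exact h ▸ (hadj' w (by grind)).symm
  exact hle.antisymm
    ((isTree_iff_minimal_connected.1 hH).le_of_le (parentGraph_isTree hfr hreach').connected hle)

section MatrixTree

open Matrix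

variable [Fintype V] [DecidableEq V]

/-- The transition matrix of the map `f`, killed at `r`. -/
def parentMatrix (f : V → V) (r : V) : Matrix V V ℝ :=
  Matrix.of fun v => if v = r then 0 else Pi.single (f v) 1

theorem parentMatrix_mulVec (f : V → V) (r : V) (x : V → ℝ) (v : V) :
    (parentMatrix f r *ᵥ x) v = if v = r then 0 else x (f v) := by
  by_cases h : v = r <;> simp [parentMatrix, mulVec, h]

theorem isNilpotent_parentMatrix {f : V → V} {r : V} (hf : ∀ v, ∃ k, f^[k] v = r) :
    IsNilpotent (parentMatrix f r) := by
  have key (x : V → ℝ) : ∀ (j : ℕ) (v : V) (k : ℕ), f^[j] v = r → j < k →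
      (parentMatrix f r ^ k *ᵥ x) v = 0 := by
    intro j
    induction j with
    | zero =>
      intro v k hv hk
      obtain ⟨k, rfl⟩ := Nat.exists_eq_succ_of_ne_zero hk.ne'
      rw [pow_succ', ← mulVec_mulVec, parentMatrix_mulVec]
      exact if_pos hv
    | succ j ih =>
      intro v k hv hk
      obtain ⟨k, rfl⟩ := Nat.exists_eq_succ_of_ne_zero (Nat.ne_zero_of_lt hk)
      rw [pow_succ', ← mulVec_mulVec, parentMatrix_mulVec, ih (f v) k hv (by omega), ite_self]
  choose d hd using hf
  refine ⟨Finset.univ.sup d + 1, Matrix.ext_of_mulVec_single fun w => funext fun v => ?_⟩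
  rw [key _ (d v) v _ (hd v) (Nat.lt_succ_of_le (Finset.le_sup (Finset.mem_univ v)))]
  simp

theorem det_one_sub_parentMatrix_of_reaches {f : V → V} {r : V} (hf : ∀ v, ∃ k, f^[k] v = r) :
    (1 - parentMatrix f r).det = 1 := by
  have h := isNilpotent_charpoly_sub_pow_of_isNilpotent (isNilpotent_parentMatrix hf)
  have h' := eval_charpoly (parentMatrix f r) 1
  rw [sub_eq_zero.1 h.eq_zero] at h'
  simpa using h'.symm

theorem det_one_sub_parentMatrix_of_not_reaches {f : V → V} {r : V}
    (hf : ¬ ∀ v, ∃ k, f^[k] v = r) : (1 - parentMatrix f r).det = 0 := by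
  classical
  push Not at hf
  obtain ⟨v, hv⟩ := hf
  refine exists_mulVec_eq_zero_iff.1
    ⟨fun w => if ∃ k, f^[k] w = r then 0 else 1, fun h => ?_, funext fun w => ?_⟩
  · have := congrFun h v
    simp [hv] at this
  · rw [sub_mulVec, one_mulVec, Pi.sub_apply, parentMatrix_mulVec]
    by_cases hw : w = r
    · have : ∃ k, f^[k] w = r := ⟨0, hw⟩
      simp [hw, hw ▸ this]
    · have : (∃ k, f^[k] w = r) ↔ ∃ k, f^[k] (f w) = r := by
        refine ⟨?_, fun ⟨k, hk⟩ => ⟨k + 1, hk⟩⟩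
        rintro ⟨_ | k, hk⟩
        · exact absurd hk hw
        · exact ⟨k, hk⟩
      simp [hw, this]

variable (G : SimpleGraph V) [DecidableRel G.Adj]

theorem lapMatrix_row (v : V) :
    G.lapMatrix ℝ v = ∑ w ∈ G.neighborFinset v, (Pi.single v 1 - Pi.single w 1) := by
  funext u
  simp only [lapMatrix, degMatrix, Matrix.sub_apply, Finset.sum_apply, Pi.sub_apply,
    Finset.sum_sub_distrib, Finset.sum_const, card_neighborFinset_eq_degree, adjMatrix_apply,
    nsmul_eq_mul]
  congr 1
  · by_cases h : v = u
    · subst h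
      simp
    · simp [h, Ne.symm h]
  · simp [Pi.single_apply]

/-- The **matrix tree theorem**: every principal cofactor of the Laplacian counts the
spanning trees. -/
theorem card_spanningTrees_eq_adjugate_lapMatrix (r : V) :
    (Nat.card {H : SimpleGraph V // H ≤ G ∧ H.IsTree} : ℝ) = (G.lapMatrix ℝ).adjugate r r := by
  classical
  set S : V → Finset V := fun v => if v = r then {r} else G.neighborFinset v with hS
  have hmem {f : V → V} :
      f ∈ Fintype.piFinset S ↔ f r = r ∧ ∀ v, v ≠ r → G.Adj v (f v) := by
    rw [Fintype.mem_piFinset]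
    refine ⟨fun h => ⟨by simpa [hS] using h r, fun v hv => by simpa [hS, hv] using h v⟩,
      fun h v => ?_⟩
    by_cases hv : v = r
    · subst hv
      simp [hS, h.1]
    · simpa [hS, hv] using h.2 v hv
  have hrows : (G.lapMatrix ℝ).updateRow r (Pi.single r 1) =
      fun v => ∑ w ∈ S v, (Pi.single v 1 - if v = r then 0 else Pi.single w 1 : V → ℝ) := by
    funext v
    by_cases hv : v = r
    · subst hv
      simp [hS]
    · rw [updateRow_ne hv, lapMatrix_row]
      simp [hS, hv]
  have hsum : (G.lapMatrix ℝ).adjugate r r =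
      ∑ f ∈ Fintype.piFinset S, (1 - parentMatrix f r).det := by
    rw [adjugate_apply, hrows]
    refine (detRowAlternating.toMultilinearMap.map_sum_finset _ _).trans
      (Finset.sum_congr rfl fun f _ => congrArg Matrix.det ?_)
    funext v
    funext u
    by_cases hv : v = r
    · simp [parentMatrix, hv, Matrix.one_apply, Pi.single_apply, eq_comm]
    · simp [parentMatrix, hv, Matrix.one_apply, Pi.single_apply, @eq_comm _ u v]
  have hcard : Nat.card {f : V → V // f ∈ Fintype.piFinset S ∧ ∀ v, ∃ k, f^[k] v = r} =
      Nat.card {H : SimpleGraph V // H ≤ G ∧ H.IsTree} := by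
    refine Nat.card_congr (Equiv.ofBijective (fun f => ⟨parentGraph f.1, ?_, ?_⟩) ⟨?_, ?_⟩)
    · obtain ⟨hr, hadj⟩ := hmem.1 f.2.1
      intro v w hvw
      obtain ⟨hne, h | h⟩ := parentGraph_adj.1 hvw
      · exact h ▸ hadj v (by grind)
      · exact h ▸ (hadj w (by grind)).symm
    · exact parentGraph_isTree (hmem.1 f.2.1).1 f.2.2
    · intro f g hfg
      exact Subtype.ext (eq_of_parentGraph_eq (hmem.1 f.2.1).1 (hmem.1 g.2.1).1 g.2.2
        (congrArg Subtype.val hfg))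
    · rintro ⟨H, hle, hH⟩
      obtain ⟨f, hr, hadj, hreach, hfH⟩ := hH.exists_parentGraph_eq r
      exact ⟨⟨f, hmem.2 ⟨hr, fun v hv => hle (hadj v hv)⟩, hreach⟩, Subtype.ext hfH⟩
  rw [← hcard, hsum, ← Finset.sum_filter_add_sum_filter_not _ fun f => ∀ v, ∃ k, f^[k] v = r,
    Finset.sum_congr rfl fun f hf =>
      det_one_sub_parentMatrix_of_reaches (Finset.mem_filter.1 hf).2,
    Finset.sum_eq_zero fun f hf =>
      det_one_sub_parentMatrix_of_not_reaches (Finset.mem_filter.1 hf).2,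
    Finset.sum_const, nsmul_one, add_zero, Nat.card_eq_fintype_card, Fintype.card_subtype]
  congr 2
  ext f
  simp

theorem sum_lapMatrix_col (u : V) : ∑ v, G.lapMatrix ℝ v u = 0 := by
  have h := congrFun (G.lapMatrix_mulVec_const_eq_zero (R := ℝ)) u
  simpa [mulVec, dotProduct, (G.isSymm_lapMatrix ℝ).apply] using h

theorem sum_lapMatrix_row (v : V) : ∑ u, G.lapMatrix ℝ v u = 0 := by
  simpa [mulVec, dotProduct] using congrFun (G.lapMatrix_mulVec_const_eq_zero (R := ℝ)) v

theorem det_lapMatrix_add_one (r : V) :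
    (G.lapMatrix ℝ + Matrix.of fun _ _ => 1).det =
      (Fintype.card V : ℝ) ^ 2 * (G.lapMatrix ℝ).adjugate r r := by
  set A : Matrix V V ℝ := G.lapMatrix ℝ + Matrix.of fun _ _ => 1 with hA
  set B : Matrix V V ℝ := (G.lapMatrix ℝ).updateRow r 1 with hB
  have hAB : A.det = Fintype.card V * B.det := by
    have h := det_updateRow_sum A r 1
    have hs : ∑ k, (1 : V → ℝ) k • A k = (Fintype.card V : ℝ) • (1 : V → ℝ) := by
      funext u
      refine (Finset.sum_apply u _ _).trans ?_
      change ∑ v, 1 * (G.lapMatrix ℝ v u + 1) = _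
      simp [Finset.sum_add_distrib, sum_lapMatrix_col]
    rw [hs, det_updateRow_smul, Pi.one_apply, one_smul] at h
    rw [← h]
    congr 1
    refine det_eq_of_forall_row_eq_smul_add_const (fun v => if v = r then 0 else 1) r (by simp) ?_
    intro v u
    by_cases hv : v = r
    · subst hv
      simp [hB]
    · simp [hB, hA, hv]
  have hBadj : B.det = Fintype.card V * B.adjugate r r := by
    have h := det_updateCol_sum B r 1
    have hs : (fun k => ∑ i, (1 : V → ℝ) i • B k i) =
        (Fintype.card V : ℝ) • (Pi.single r 1 : V → ℝ) := by
      funext v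
      by_cases hv : v = r
      · subst hv
        simp [hB]
      · simp [hB, hv, sum_lapMatrix_row]
    rw [hs, det_updateCol_smul, Pi.one_apply, one_smul] at h
    have ht : Bᵀ.adjugate r r = B.adjugate r r := by
      rw [← adjugate_transpose, transpose_apply]
    rw [← h, ← ht, adjugate_apply, updateRow_transpose, det_transpose]
  have hadj : B.adjugate r r = (G.lapMatrix ℝ).adjugate r r := by
    rw [adjugate_apply, adjugate_apply, hB, updateRow_idem]
  rw [hAB, hBadj, hadj]
  ring

theorem lapMatrix_mulVec_eq_sum (x : V → ℝ) (v : V) :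
    (G.lapMatrix ℝ *ᵥ x) v = ∑ u ∈ G.neighborFinset v, (x v - x u) := by
  simp [lapMatrix_mulVec_apply]

theorem sum_eq_zero_of_lapMatrix_mulVec {x : V → ℝ} {μ : ℝ} (hμ : μ ≠ 0)
    (h : G.lapMatrix ℝ *ᵥ x = μ • x) : ∑ v, x v = 0 := by
  have h1 : ∑ v, (G.lapMatrix ℝ *ᵥ x) v = 0 := by
    simp only [mulVec, dotProduct]
    rw [Finset.sum_comm]
    simp [← Finset.sum_mul, sum_lapMatrix_col]
  rw [h] at h1
  simpa [← Finset.mul_sum, hμ] using h1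

theorem lapMatrix_boxProd_mulVec {W : Type*} [Fintype W] [DecidableEq W] (H : SimpleGraph W)
    [DecidableRel H.Adj] [DecidableRel (G □ H).Adj] {x : V → ℝ} {y : W → ℝ} {μ ν : ℝ}
    (hx : G.lapMatrix ℝ *ᵥ x = μ • x) (hy : H.lapMatrix ℝ *ᵥ y = ν • y) :
    (G □ H).lapMatrix ℝ *ᵥ (fun p => x p.1 * y p.2) = (μ + ν) • fun p => x p.1 * y p.2 := by
  funext ⟨v, w⟩
  have hv := congrFun hx v
  have hw := congrFun hy w
  rw [lapMatrix_mulVec_eq_sum, Pi.smul_apply, smul_eq_mul] at hv hw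
  rw [lapMatrix_mulVec_eq_sum]
  have hdisj : Disjoint (G.neighborFinset v ×ˢ {w}) ({v} ×ˢ H.neighborFinset w) := by
    rw [Finset.disjoint_left]
    rintro ⟨a, b⟩ h1 h2
    simp only [Finset.mem_product, mem_neighborFinset, Finset.mem_singleton] at h1 h2
    exact h1.1.ne h2.1.symm
  rw [Finset.sum_congr (s₂ := (G.neighborFinset v ×ˢ {w}).disjUnion _ hdisj)
    (by ext ⟨a, b⟩; simp [boxProd_adj, eq_comm]) fun _ _ => rfl,
    Finset.sum_disjUnion, Finset.sum_product, Finset.sum_product]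
  simp only [Finset.sum_singleton, ← sub_mul, ← mul_sub, ← Finset.sum_mul, ← Finset.mul_sum, hv,
    hw, Pi.smul_apply, smul_eq_mul]
  ring

end MatrixTree

section PathGraph

open Matrix Real

/-- The eigenvectors of the Laplacian of the path graph. -/
noncomputable def pathCos (n : ℕ) (j : ℕ) (x : Fin n) : ℝ :=
  cos (π * j / n * (x + 1 / 2))

theorem pathCos_zero (n : ℕ) (x : Fin n) : pathCos n 0 x = 1 := by
  simp [pathCos]

theorem pathGraph_lapMatrix_mulVec_apply (n : ℕ) [DecidableRel (pathGraph n).Adj] (g : ℕ → ℝ)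
    (x : Fin n) :
    ((pathGraph n).lapMatrix ℝ *ᵥ fun y => g y) x =
      (if (x : ℕ) + 1 < n then g x - g (x + 1) else 0) +
        if 0 < (x : ℕ) then g x - g (x - 1) else 0 := by
  have h : ((pathGraph n).lapMatrix ℝ *ᵥ fun y => g y) x =
      ∑ u : Fin n, ((if (x : ℕ) + 1 = u then g x - g u else 0) +
        if (u : ℕ) + 1 = x then g x - g u else 0) := by
    rw [lapMatrix_mulVec_eq_sum, neighborFinset_eq_filter, Finset.sum_filter]
    refine Finset.sum_congr rfl fun u _ => ?_
    have hadj := pathGraph_adj (u := x) (v := u)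
    grind
  rw [h, Finset.sum_add_distrib,
    Fin.sum_univ_eq_sum_range (fun u => if (x : ℕ) + 1 = u then g x - g u else 0) n,
    Fin.sum_univ_eq_sum_range (fun u => if u + 1 = (x : ℕ) then g x - g u else 0) n]
  congr 1
  · simp
  · obtain ⟨x, hx⟩ := x
    cases x with
    | zero => simp
    | succ y =>
      have hy : y < n := by omega
      simp [hy]

theorem pathGraph_lapMatrix_mulVec_pathCos (n j : ℕ) [DecidableRel (pathGraph n).Adj] :
    (pathGraph n).lapMatrix ℝ *ᵥ pathCos n j = (2 - 2 * cos (π * j / n)) • pathCos n j := by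
  funext x
  have hn : (n : ℝ) ≠ 0 := by
    have := x.pos
    positivity
  set θ : ℝ := π * j / n with hθ
  have hθn : θ * n = j * π := by
    rw [hθ]
    field_simp
  set g : ℕ → ℝ := fun y => cos (θ * (y + 1 / 2)) with hg
  have hright : (if (x : ℕ) + 1 < n then g x - g (x + 1) else 0) = g x - g (x + 1) := by
    split_ifs with h
    · rfl
    · have hx : ((x : ℕ) : ℝ) + 1 = n := by
        have := x.isLt
        exact_mod_cast (show (x : ℕ) + 1 = n by omega)
      simp only [hg]
      push_cast
      rw [hx, show θ * ((x : ℕ) + 1 / 2) = θ * n - θ / 2 by rw [← hx]; ring,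
        show θ * (n + 1 / 2) = θ * n + θ / 2 by ring, hθn, cos_sub, cos_add, sin_nat_mul_pi]
      ring
  have hleft : (if 0 < (x : ℕ) then g x - g (x - 1) else 0) =
      g x - cos (θ * (x - 1 / 2)) := by
    split_ifs with h
    · simp only [hg]
      rw [Nat.cast_sub (by omega : 1 ≤ (x : ℕ))]
      push_cast
      ring_nf
    · have hx : (x : ℕ) = 0 := by omega
      simp only [hg, hx]
      rw [eq_comm, sub_eq_zero, ← cos_neg]
      push_cast
      ring_nf
  have hmain := pathGraph_lapMatrix_mulVec_apply n g x
  rw [hright, hleft] at hmain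
  refine hmain.trans ?_
  simp only [hg, Pi.smul_apply, smul_eq_mul, pathCos]
  push_cast
  rw [show θ * ((x : ℕ) + 1 + 1 / 2) = θ * ((x : ℕ) + 1 / 2) + θ by ring,
    show θ * ((x : ℕ) - 1 / 2) = θ * ((x : ℕ) + 1 / 2) - θ by ring, cos_add, cos_sub]
  ring

theorem cos_pi_mul_div_injective (n : ℕ) :
    Function.Injective fun j : Fin n => cos (π * (j : ℕ) / n) := by
  intro i j hij
  have hn : (0 : ℝ) < n := by
    have := i.pos
    positivity
  have hmem (k : Fin n) : π * (k : ℕ) / n ∈ Set.Icc 0 π := by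
    refine ⟨by positivity, ?_⟩
    rw [div_le_iff₀ hn]
    have : ((k : ℕ) : ℝ) ≤ n := by exact_mod_cast k.isLt.le
    gcongr
  have h := injOn_cos (hmem i) (hmem j) hij
  field_simp at h
  exact Fin.ext (by exact_mod_cast h)

theorem pathCos_ne_zero {n : ℕ} (j : Fin n) : pathCos n j ≠ 0 := by
  intro h
  have hpos := j.pos
  have hn : (0 : ℝ) < n := by positivity
  have h0 := congrFun h ⟨0, hpos⟩
  have hlt : ((j : ℕ) : ℝ) < n := by exact_mod_cast j.isLt
  refine (cos_pos_of_mem_Ioo ⟨?_, ?_⟩).ne' h0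
  · have : 0 ≤ π * (j : ℕ) / n * (((⟨0, hpos⟩ : Fin n) : ℕ) + 1 / 2) := by positivity
    linarith [pi_pos]
  · have : π * (j : ℕ) / n < π := by
      rw [div_lt_iff₀ hn]
      gcongr
    simp only [Nat.cast_zero]
    linarith

theorem det_pathCos_ne_zero (n : ℕ) :
    (Matrix.of fun j : Fin n => pathCos n j).det ≠ 0 := by
  classical
  have hli : LinearIndependent ℝ fun j : Fin n => pathCos n j := by
    refine Module.End.eigenvectors_linearIndependent'
      (Matrix.toLin' ((pathGraph n).lapMatrix ℝ)) (fun j : Fin n => 2 - 2 * cos (π * (j : ℕ) / n)) ?_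
      (fun j : Fin n => pathCos n j)
      fun j => ?_
    · intro i j hij
      exact cos_pi_mul_div_injective n (by simp only at hij ⊢; linarith)
    · refine Module.End.hasEigenvector_iff.2 ⟨Module.End.mem_eigenspace_iff.2 ?_, pathCos_ne_zero j⟩
      rw [toLin'_apply, pathGraph_lapMatrix_mulVec_pathCos]
  exact ((isUnit_iff_isUnit_det _).1 (linearIndependent_rows_iff_isUnit.1 hli)).ne_zero

theorem sum_pathCos {n : ℕ} {j : Fin n} (hj : (j : ℕ) ≠ 0) : ∑ x, pathCos n j x = 0 := by
  classical
  refine sum_eq_zero_of_lapMatrix_mulVec _ ?_ (pathGraph_lapMatrix_mulVec_pathCos n j)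
  intro h
  refine hj (congrArg Fin.val (cos_pi_mul_div_injective n (a₂ := ⟨0, j.pos⟩) ?_))
  simp only [Nat.cast_zero, mul_zero, zero_div, cos_zero]
  linarith

end PathGraph

end SimpleGraph

open SimpleGraph in
theorem gridGraph_eq_boxProd (ℓ m : ℕ) : gridGraph ℓ m = pathGraph ℓ □ pathGraph m := by
  ext ⟨a, b⟩ ⟨c, d⟩
  simp only [gridGraph, fromRel_adj, boxProd_adj, pathGraph_adj, ne_eq, Prod.mk.injEq, Fin.ext_iff]
  omega

open SimpleGraph Matrix in
theorem det_lapMatrix_grid_add_one (ℓ m : ℕ) (hl : 0 < ℓ) (hm : 0 < m)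
    [DecidableRel (pathGraph ℓ □ pathGraph m).Adj] :
    ((pathGraph ℓ □ pathGraph m).lapMatrix ℝ + Matrix.of fun _ _ => 1).det =
      (ℓ * m : ℝ) * ∏ jk ∈ (Finset.range ℓ ×ˢ Finset.range m).erase (0, 0),
        (4 - 2 * Real.cos (Real.pi * jk.1 / ℓ) - 2 * Real.cos (Real.pi * jk.2 / m)) := by
  classical
  set A := (pathGraph ℓ □ pathGraph m).lapMatrix ℝ + Matrix.of fun _ _ => 1 with hA
  set F : Matrix (Fin ℓ × Fin m) (Fin ℓ × Fin m) ℝ :=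
    kroneckerMap (· * ·) (Matrix.of fun j : Fin ℓ => pathCos ℓ j)
      (Matrix.of fun k : Fin m => pathCos m k) with hF
  have hdetF : F.det ≠ 0 := by
    rw [hF]
    exact (det_kronecker _ _).trans_ne (mul_ne_zero (pow_ne_zero _ (det_pathCos_ne_zero ℓ))
      (pow_ne_zero _ (det_pathCos_ne_zero m)))
  set μ : ℕ × ℕ → ℝ := fun jk => if jk = (0, 0) then (ℓ * m : ℝ) else
    4 - 2 * Real.cos (Real.pi * jk.1 / ℓ) - 2 * Real.cos (Real.pi * jk.2 / m) with hμ
  have hrow (p : Fin ℓ × Fin m) : A *ᵥ F p = μ (p.1, p.2) • F p := by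
    have hFp : F p = fun q => pathCos ℓ p.1 q.1 * pathCos m p.2 q.2 := rfl
    have hones : (Matrix.of fun _ _ => 1 : Matrix (Fin ℓ × Fin m) (Fin ℓ × Fin m) ℝ) *ᵥ F p =
        fun _ => (∑ x, pathCos ℓ p.1 x) * ∑ y, pathCos m p.2 y := by
      funext q
      simp [mulVec, dotProduct, hFp, Fintype.sum_prod_type, Finset.sum_mul_sum]
    rw [hA, add_mulVec, hones, hFp, lapMatrix_boxProd_mulVec _ _
      (pathGraph_lapMatrix_mulVec_pathCos ℓ p.1) (pathGraph_lapMatrix_mulVec_pathCos m p.2)]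
    funext q
    by_cases h1 : (p.1 : ℕ) = 0
    · by_cases h2 : (p.2 : ℕ) = 0
      · simp [hμ, h1, h2, pathCos_zero]
      · simp only [hμ, h2, sum_pathCos h2, Pi.add_apply, Pi.smul_apply, smul_eq_mul, Prod.mk.injEq,
          and_false, if_false]
        ring
    · simp only [hμ, h1, sum_pathCos h1, Pi.add_apply, Pi.smul_apply, smul_eq_mul, Prod.mk.injEq,
        false_and, if_false]
      ring
  have hmul : A * Fᵀ = Fᵀ * diagonal fun p : Fin ℓ × Fin m => μ (p.1, p.2) := by
    ext q p
    rw [mul_diagonal, mul_comm]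
    exact congrFun (hrow p) q
  have hdet : A.det = ∏ p : Fin ℓ × Fin m, μ (p.1, p.2) := by
    have h := congrArg Matrix.det hmul
    rw [det_mul, det_mul, det_transpose, det_diagonal, mul_comm] at h
    exact mul_left_cancel₀ hdetF h
  have hprod : ∏ p : Fin ℓ × Fin m, μ (p.1, p.2) =
      ∏ jk ∈ Finset.range ℓ ×ˢ Finset.range m, μ jk := by
    rw [Fintype.prod_prod_type, Finset.prod_product, Finset.prod_range]
    exact Finset.prod_congr rfl fun j _ => (Finset.prod_range fun k => μ (j, k)).symm
  rw [hdet, hprod, ← Finset.mul_prod_erase _ _ (a := (0, 0)) (by simp [hl, hm])]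
  congr 1
  refine Finset.prod_congr rfl fun jk h => ?_
  rw [hμ]
  exact if_neg (Finset.ne_of_mem_erase h)

/-- The number of spanning trees of the `ℓ × m` grid graph equals
`(1/(ℓm)) ∏ [4 - 2cos(πj/ℓ) - 2cos(πk/m)]`, the product being over all pairs
`(j,k)` with `0 ≤ j ≤ ℓ-1`, `0 ≤ k ≤ m-1` except `(0,0)`. -/
theorem stmt8 (ℓ m : ℕ) (hl : 0 < ℓ) (hm : 0 < m) :
    (Nat.card {H : SimpleGraph (Fin ℓ × Fin m) // H ≤ gridGraph ℓ m ∧ H.IsTree} : ℝ)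
      = (1 / (ℓ * m : ℝ)) *
          ∏ jk ∈ (Finset.range ℓ ×ˢ Finset.range m).erase (0, 0),
            (4 - 2 * Real.cos (Real.pi * jk.1 / ℓ) - 2 * Real.cos (Real.pi * jk.2 / m)) := by
  classical
  have hcard := SimpleGraph.card_spanningTrees_eq_adjugate_lapMatrix
    (SimpleGraph.pathGraph ℓ □ SimpleGraph.pathGraph m) (⟨0, hl⟩, ⟨0, hm⟩)
  have hdet := SimpleGraph.det_lapMatrix_add_one
    (SimpleGraph.pathGraph ℓ □ SimpleGraph.pathGraph m) (⟨0, hl⟩, ⟨0, hm⟩)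
  rw [det_lapMatrix_grid_add_one ℓ m hl hm, ← hcard, Fintype.card_prod, Fintype.card_fin,
    Fintype.card_fin, Nat.cast_mul] at hdet
  have hl' : (ℓ : ℝ) ≠ 0 := by positivity
  have hm' : (m : ℝ) ≠ 0 := by positivity
  rw [gridGraph_eq_boxProd]
  refine mul_left_cancel₀ (pow_ne_zero 2 (mul_ne_zero hl' hm')) (hdet.symm.trans ?_)
  field_simp
end

section
/- The number of spanning trees of the triangular grid region with Dirichlet boundary (the graph whose Laplacian is the negative Laplacian of Z² restricted to points (x,y) with 0 < y < x < m together with the antisymmetric treatment of the diagonal) equals ∏_{0<j<k<m} [4 − 2cos(πj/m) − 2cos(πk/m)]. -/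
/-- The matrix of `1 - par`, where `par` is a partial self-map of `V` presented as a map into a
larger type `X` containing `V` through `ι`. -/
def parentMatrix {V X : Type*} (R : Type*) [CommRing R] [DecidableEq V] [DecidableEq X]
    (ι : V → X) (par : V → X) : Matrix V V R :=
  Matrix.of fun v w => (if v = w then 1 else 0) - if par v = ι w then 1 else 0

section MatrixTree

variable {V X R : Type*} [Fintype V] [DecidableEq V] [DecidableEq X] [CommRing R]
  {ι : V → X} {par : V → X}

theorem det_parentMatrix_of_acyclic
    (h : ∀ v, ¬ Relation.TransGen (fun a b => par a = ι b) v v) :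
    (parentMatrix R ι par).det = 1 := by
  classical
  set r : V → V → Prop := fun a b => par a = ι b with hr
  let depth : V → ℕ := fun v => (Finset.univ.filter fun w => Relation.TransGen r v w).card
  have depth_lt {v w : V} (hvw : r v w) : depth w < depth v := by
    refine Finset.card_lt_card (Finset.ssubset_iff_of_subset ?_ |>.2 ⟨w, ?_, ?_⟩)
    · intro u hu
      simp only [Finset.mem_filter, Finset.mem_univ, true_and] at hu ⊢
      exact .head hvw hu
    · simpa using Relation.TransGen.single hvw
    · simpa using h w
  have htri : (parentMatrix R ι par).BlockTriangular (OrderDual.toDual ∘ depth) := by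
    intro v w hvw
    have hlt : depth v < depth w := hvw
    have h1 : v ≠ w := by rintro rfl; exact lt_irrefl _ hlt
    have h2 : par v ≠ ι w := fun h' => lt_asymm hlt (depth_lt h')
    simp [parentMatrix, h1, h2]
  rw [htri.det]
  refine Finset.prod_eq_one fun d _ => ?_
  have hone : (parentMatrix R ι par).toSquareBlock (OrderDual.toDual ∘ depth) d = 1 := by
    ext ⟨v, hv⟩ ⟨w, hw⟩
    have h2 : par v ≠ ι w := fun h' =>
      (depth_lt h').ne (OrderDual.toDual.injective (hw.trans hv.symm))
    simp [parentMatrix, Matrix.toSquareBlock, Matrix.toSquareBlockProp, Matrix.one_apply, h2]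
  rw [hone, Matrix.det_one]

theorem det_parentMatrix_of_cycle [IsDomain R] (hι : Function.Injective ι) {p : V}
    (hp : Relation.TransGen (fun a b => par a = ι b) p p) :
    (parentMatrix R ι par).det = 0 := by
  classical
  set r : V → V → Prop := fun a b => par a = ι b with hr
  have reaches_iff {v w : V} (hvw : r v w) :
      Relation.ReflTransGen r v p ↔ Relation.ReflTransGen r w p := by
    have step {a : V} (ha : Relation.TransGen r v a) : Relation.ReflTransGen r w a := by
      obtain ⟨c, hc, hca⟩ := Relation.TransGen.head'_iff.1 ha
      rwa [← hι (hc.symm.trans hvw)]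
    refine ⟨fun hv => ?_, .head hvw⟩
    rcases Relation.reflTransGen_iff_eq_or_transGen.1 hv with rfl | hv
    · exact step hp
    · exact step hv
  refine Matrix.exists_mulVec_eq_zero_iff.1
    ⟨fun v => if Relation.ReflTransGen r v p then 1 else 0, fun h0 => ?_, ?_⟩
  · simpa [Relation.ReflTransGen.refl] using congrFun h0 p
  · ext v
    simp only [parentMatrix, Matrix.mulVec, dotProduct, Matrix.of_apply, sub_mul, ite_mul, one_mul,
      zero_mul, Finset.sum_sub_distrib, Finset.sum_ite_eq, Finset.mem_univ, if_true, Pi.zero_apply]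
    by_cases hv : ∃ w, r v w
    · obtain ⟨w, hw⟩ := hv
      rw [Finset.sum_eq_single w]
      · have hw' : par v = ι w := hw
        simp only [hw', if_true, reaches_iff hw, sub_self]
      · intro u _ hu
        exact if_neg fun h' => hu (hι (h'.symm.trans hw))
      · simp
    · push Not at hv
      rw [Finset.sum_eq_zero fun w _ => if_neg (hv w), if_neg, sub_zero]
      intro hvp
      rcases Relation.reflTransGen_iff_eq_or_transGen.1 hvp with rfl | hvp
      · obtain ⟨c, hc, -⟩ := Relation.TransGen.head'_iff.1 hp
        exact hv c hc
      · obtain ⟨c, hc, -⟩ := Relation.TransGen.head'_iff.1 hvp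
        exact hv c hc

/-- **Matrix tree theorem** for the graph on `V` with a wired root, where `v` has one edge for each
element of `N v ⊆ X` and the points of `X` outside the range of `ι` are identified to the root. -/
theorem natCard_acyclic_eq_det [IsDomain R] (hι : Function.Injective ι) (N : V → Finset X) :
    (Nat.card {par : V → X // (∀ v, par v ∈ N v) ∧
        ∀ v, ¬ Relation.TransGen (fun a b => par a = ι b) v v} : R) =
      (Matrix.of fun v w => ∑ c ∈ N v,
        ((if v = w then 1 else 0) - if c = ι w then 1 else 0 : R)).det := by
  classical
  have hexpand : (Matrix.of fun v w => ∑ c ∈ N v,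
        ((if v = w then 1 else 0) - if c = ι w then 1 else 0 : R)).det =
      ∑ par ∈ Fintype.piFinset N, (parentMatrix R ι par).det := by
    have := (Matrix.detRowAlternating (R := R) (n := V)).toMultilinearMap.map_sum_finset
      (fun v c w => (if v = w then 1 else 0) - if c = ι w then 1 else 0) N
    refine Eq.trans (congrArg Matrix.det ?_) this
    ext v w
    simp
  have hdet (par : V → X) : (parentMatrix R ι par).det =
      if ∀ v, ¬ Relation.TransGen (fun a b => par a = ι b) v v then 1 else 0 := by
    split_ifs with h
    · exact det_parentMatrix_of_acyclic h
    · push Not at h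
      obtain ⟨p, hp⟩ := h
      exact det_parentMatrix_of_cycle hι hp
  rw [hexpand, Finset.sum_congr rfl fun par _ => hdet par, Finset.sum_boole,
    Nat.subtype_card]
  intro par
  simp [Fintype.mem_piFinset]

end MatrixTree

section Sine

open Real

/-- The Dirichlet eigenfunction `x ↦ sin (π j x / m)` of the path `0, …, m`. -/
noncomputable def sineMode (m : ℕ) (j x : ℤ) : ℝ := sin (π * j * x / m)

theorem sineMode_zero (m : ℕ) (j : ℤ) : sineMode m j 0 = 0 := by simp [sineMode]

theorem sineMode_self {m : ℕ} (hm : m ≠ 0) (j : ℤ) : sineMode m j m = 0 := by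
  have : (π * j * (m : ℤ) / m : ℝ) = j * π := by
    push_cast; field_simp
  rw [sineMode, this, sin_int_mul_pi]

theorem sineMode_add_one_add_sub_one (m : ℕ) (j x : ℤ) :
    sineMode m j (x + 1) + sineMode m j (x - 1) = 2 * cos (π * j / m) * sineMode m j x := by
  have h1 : (π * j * (x + 1 : ℤ) / m : ℝ) = π * j * x / m + π * j / m := by push_cast; ring
  have h2 : (π * j * (x - 1 : ℤ) / m : ℝ) = π * j * x / m - π * j / m := by push_cast; ring
  rw [sineMode, sineMode, sineMode, h1, h2, sin_add, sin_sub]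
  ring

theorem sum_sineMode_mul_sineMode_of_ne {m : ℕ} {j k : ℤ} (hj : j ∈ Set.Ioo 0 (m : ℤ))
    (hk : k ∈ Set.Ioo 0 (m : ℤ)) (hjk : j ≠ k) :
    ∑ x ∈ Finset.range m, sineMode m j x * sineMode m k x = 0 := by
  have hm : m ≠ 0 := by rintro rfl; simp only [Set.mem_Ioo] at hj; omega
  have hm' : (0 : ℝ) < m := by positivity
  have hmem {i : ℤ} (hi : i ∈ Set.Ioo 0 (m : ℤ)) : π * i / m ∈ Set.Icc 0 π := by
    have h1 : (0 : ℝ) < i := by exact_mod_cast hi.1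
    have h2 : (i : ℝ) ≤ m := by exact_mod_cast hi.2.le
    refine ⟨by positivity, ?_⟩
    rw [div_le_iff₀ hm']
    exact mul_le_mul_of_nonneg_left h2 pi_pos.le
  have hcos : cos (π * j / m) - cos (π * k / m) ≠ 0 := by
    refine sub_ne_zero.2 fun h => hjk ?_
    have := injOn_cos (hmem hj) (hmem hk) h
    field_simp at this
    exact_mod_cast this
  let W : ℕ → ℝ := fun x => sineMode m j x * sineMode m k (x - 1) -
    sineMode m j (x - 1) * sineMode m k x
  have htel : ∑ x ∈ Finset.range m, (W (x + 1) - W x) = W m - W 0 := Finset.sum_range_sub W m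
  have hterm (x : ℕ) : W (x + 1) - W x =
      2 * (cos (π * j / m) - cos (π * k / m)) * (sineMode m j x * sineMode m k x) := by
    have h1 := sineMode_add_one_add_sub_one m j x
    have h2 := sineMode_add_one_add_sub_one m k x
    simp only [W, Nat.cast_add, Nat.cast_one, add_sub_cancel_right]
    linear_combination sineMode m k x * h1 - sineMode m j x * h2
  have hW : W m - W 0 = 0 := by simp [W, sineMode_zero, sineMode_self hm]
  rw [Finset.sum_congr rfl fun x _ => hterm x, ← Finset.mul_sum, hW] at htel
  exact (mul_eq_zero.1 htel).resolve_left (mul_ne_zero two_ne_zero hcos)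

theorem sum_sineMode_mul_self_pos {m : ℕ} {j : ℤ} (hm : 1 < m) (hj : j ∈ Set.Ioo 0 (m : ℤ)) :
    0 < ∑ x ∈ Finset.range m, sineMode m j x * sineMode m j x := by
  refine Finset.sum_pos' (fun x _ => mul_self_nonneg _) ⟨1, by simpa using hm, ?_⟩
  have hm' : (0 : ℝ) < m := by positivity
  have h1 : (0 : ℝ) < j := by exact_mod_cast hj.1
  have h2 : (j : ℝ) < m := by exact_mod_cast hj.2
  have : 0 < sineMode m j (1 : ℕ) := by
    refine sin_pos_of_pos_of_lt_pi (by simp; positivity) ?_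
    rw [div_lt_iff₀ hm']
    simpa using mul_lt_mul_of_pos_left h2 pi_pos
  positivity

end Sine

/-- The **Cauchy–Binet formula** for `2 × 2` minors. -/
theorem sum_range_sum_range_minor_mul_minor {R : Type*} [CommRing R] (a b c d : ℕ → R) (n : ℕ) :
    ∑ x ∈ Finset.range n, ∑ y ∈ Finset.range x,
        (a x * b y - b x * a y) * (c x * d y - d x * c y) =
      (∑ x ∈ Finset.range n, a x * c x) * (∑ x ∈ Finset.range n, b x * d x) -
        (∑ x ∈ Finset.range n, a x * d x) * (∑ x ∈ Finset.range n, b x * c x) := by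
  induction n with
  | zero => simp
  | succ n ih =>
    have hrow : ∑ y ∈ Finset.range n, (a n * b y - b n * a y) * (c n * d y - d n * c y) =
        a n * c n * ∑ x ∈ Finset.range n, b x * d x - a n * d n * ∑ x ∈ Finset.range n, b x * c x
          - b n * c n * ∑ x ∈ Finset.range n, a x * d x
          + b n * d n * ∑ x ∈ Finset.range n, a x * c x := by
      simp only [Finset.mul_sum, ← Finset.sum_sub_distrib, ← Finset.sum_add_distrib]
      exact Finset.sum_congr rfl fun y _ => by ring
    simp only [Finset.sum_range_succ, ih, hrow]
    ring

section Triangle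

open Real

/-- The triangular grid region `0 < y < x < m`. -/
abbrev TriRegion (m : ℕ) : Type := {p : ℤ × ℤ // 0 < p.2 ∧ p.2 < p.1 ∧ p.1 < m}

instance (m : ℕ) : Finite (TriRegion m) := by
  refine Finite.of_injective (β := Set.Ioo (0 : ℤ) m × Set.Ioo (0 : ℤ) m)
    (fun p => (⟨p.1.1, ?_⟩, ⟨p.1.2, ?_⟩)) ?_
  · have := p.2; simp only [Set.mem_Ioo]; omega
  · have := p.2; simp only [Set.mem_Ioo]; omega
  · intro p q h
    simp only [Prod.mk.injEq, Subtype.mk.injEq] at h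
    exact Subtype.ext (Prod.ext h.1 h.2)

noncomputable instance (m : ℕ) : Fintype (TriRegion m) := Fintype.ofFinite _

theorem TriRegion.fst_mem_Ioo {m : ℕ} (p : TriRegion m) : p.1.1 ∈ Set.Ioo 0 (m : ℤ) :=
  ⟨p.2.1.trans p.2.2.1, p.2.2.2⟩

theorem TriRegion.snd_mem_Ioo {m : ℕ} (p : TriRegion m) : p.1.2 ∈ Set.Ioo 0 (m : ℤ) :=
  ⟨p.2.1, p.2.2.1.trans p.2.2.2⟩

theorem sum_triRegion {M : Type*} [AddCommMonoid M] {m : ℕ} {f : ℤ × ℤ → M}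
    (hf : ∀ x, f (x, 0) = 0) :
    ∑ p : TriRegion m, f p.1 = ∑ x ∈ Finset.range m, ∑ y ∈ Finset.range x, f (x, y) := by
  rw [Finset.sum_sigma']
  refine Finset.sum_of_injOn (fun p => ⟨p.1.1.toNat, p.1.2.toNat⟩) ?_ ?_ ?_ ?_
  · rintro ⟨⟨x, y⟩, hp⟩ - ⟨⟨x', y'⟩, hp'⟩ - h
    simp only [Sigma.mk.injEq, heq_eq_eq] at h
    simp only [Subtype.mk.injEq, Prod.mk.injEq]
    dsimp only at hp hp'
    omega
  · rintro ⟨⟨x, y⟩, hp⟩ -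
    simp only [Finset.coe_sigma, Set.mem_sigma_iff, SetLike.mem_coe, Finset.mem_range]
    dsimp only at hp
    omega
  · rintro ⟨x, y⟩ hxy hnot
    simp only [Finset.mem_sigma, Finset.mem_range] at hxy
    obtain rfl | hy := Nat.eq_zero_or_pos y
    · exact hf x
    · refine absurd ⟨⟨((x : ℤ), (y : ℤ)), ?_⟩, by simp, by simp⟩ hnot
      dsimp only
      omega
  · rintro ⟨⟨x, y⟩, hp⟩ -
    dsimp only at hp ⊢
    rw [Int.toNat_of_nonneg (by omega), Int.toNat_of_nonneg (by omega)]

/-- The antisymmetrized product of two sine modes, evaluated at the lattice point `p`. -/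
noncomputable def triMode (m : ℕ) (k p : ℤ × ℤ) : ℝ :=
  sineMode m k.1 p.1 * sineMode m k.2 p.2 - sineMode m k.2 p.1 * sineMode m k.1 p.2

/-- The eigenvalue of the negative lattice Laplacian on `triMode m k`. -/
noncomputable def triEigenvalue (m : ℕ) (k : ℤ × ℤ) : ℝ :=
  4 - 2 * cos (π * k.2 / m) - 2 * cos (π * k.1 / m)

/-- The four lattice neighbours of a point. -/
def latticeNeighbors (p : ℤ × ℤ) : Finset (ℤ × ℤ) :=
  {(p.1 + 1, p.2), (p.1 - 1, p.2), (p.1, p.2 + 1), (p.1, p.2 - 1)}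

theorem mem_latticeNeighbors {p c : ℤ × ℤ} :
    c ∈ latticeNeighbors p ↔ |p.1 - c.1| + |p.2 - c.2| = 1 := by
  simp only [latticeNeighbors, Finset.mem_insert, Finset.mem_singleton, Prod.ext_iff]
  rcases abs_cases (p.1 - c.1) with ⟨h1, h1'⟩ | ⟨h1, h1'⟩ <;>
    rcases abs_cases (p.2 - c.2) with ⟨h2, h2'⟩ | ⟨h2, h2'⟩ <;>
    rw [h1, h2] <;> omega

theorem sum_latticeNeighbors {M : Type*} [AddCommMonoid M] (p : ℤ × ℤ) (f : ℤ × ℤ → M) :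
    ∑ c ∈ latticeNeighbors p, f c =
      f (p.1 + 1, p.2) + (f (p.1 - 1, p.2) + (f (p.1, p.2 + 1) + f (p.1, p.2 - 1))) := by
  rw [latticeNeighbors, Finset.sum_insert, Finset.sum_insert, Finset.sum_insert,
    Finset.sum_singleton]
  all_goals
    simp only [Finset.mem_insert, Finset.mem_singleton, Prod.ext_iff]
    omega

theorem sum_latticeNeighbors_triMode (m : ℕ) (k p : ℤ × ℤ) :
    ∑ c ∈ latticeNeighbors p, (triMode m k p - triMode m k c) =
      triEigenvalue m k * triMode m k p := by
  rw [sum_latticeNeighbors]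
  simp only [triMode, triEigenvalue]
  have h11 := sineMode_add_one_add_sub_one m k.1 p.1
  have h12 := sineMode_add_one_add_sub_one m k.1 p.2
  have h21 := sineMode_add_one_add_sub_one m k.2 p.1
  have h22 := sineMode_add_one_add_sub_one m k.2 p.2
  linear_combination -sineMode m k.2 p.2 * h11 + sineMode m k.2 p.1 * h12 +
    sineMode m k.1 p.2 * h21 - sineMode m k.1 p.1 * h22

theorem triMode_eq_zero_of_not_mem {m : ℕ} (k : ℤ × ℤ) (p : TriRegion m) {c : ℤ × ℤ}
    (hc : c ∈ latticeNeighbors p.1) (hnot : ¬(0 < c.2 ∧ c.2 < c.1 ∧ c.1 < m)) :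
    triMode m k c = 0 := by
  obtain ⟨⟨x, y⟩, hp⟩ := p
  obtain ⟨u, v⟩ := c
  simp only [latticeNeighbors, Finset.mem_insert, Finset.mem_singleton, Prod.ext_iff] at hp hc hnot
  have hm : m ≠ 0 := by omega
  have hbdry : u = m ∨ v = 0 ∨ u = v := by omega
  rcases hbdry with rfl | rfl | rfl
  · simp [triMode, sineMode_self hm]
  · simp [triMode, sineMode_zero]
  · simp only [triMode]; ring

/-- The Dirichlet negative Laplacian of the triangular region. -/
noncomputable def triLaplacian (m : ℕ) : Matrix (TriRegion m) (TriRegion m) ℝ :=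
  Matrix.of fun v w => ∑ c ∈ latticeNeighbors v.1,
    ((if v = w then 1 else 0) - if c = w.1 then 1 else 0)

/-- The matrix whose columns are the antisymmetrized sine modes. -/
noncomputable def triModeMatrix (m : ℕ) : Matrix (TriRegion m) (TriRegion m) ℝ :=
  Matrix.of fun p k => triMode m k.1 p.1

theorem triLaplacian_mul_triModeMatrix (m : ℕ) :
    triLaplacian m * triModeMatrix m =
      triModeMatrix m * Matrix.diagonal fun k => triEigenvalue m k.1 := by
  ext p k
  rw [Matrix.mul_diagonal, Matrix.mul_apply]
  simp only [triLaplacian, triModeMatrix, Matrix.of_apply, Finset.sum_mul]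
  rw [Finset.sum_comm, mul_comm, ← sum_latticeNeighbors_triMode]
  refine Finset.sum_congr rfl fun c hc => ?_
  simp only [sub_mul, ite_mul, one_mul, zero_mul, Finset.sum_sub_distrib, Finset.sum_ite_eq,
    Finset.mem_univ, if_true, sub_right_inj]
  by_cases hmem : 0 < c.2 ∧ c.2 < c.1 ∧ c.1 < m
  · rw [Finset.sum_eq_single ⟨c, hmem⟩]
    · simp
    · intro w _ hw
      exact if_neg fun h => hw (Subtype.ext h.symm)
    · simp
  · rw [triMode_eq_zero_of_not_mem k.1 p hc hmem]
    refine Finset.sum_eq_zero fun w _ => if_neg ?_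
    rintro rfl
    exact hmem w.2

theorem triModeMatrix_transpose_mul_self (m : ℕ) :
    (triModeMatrix m).transpose * triModeMatrix m = Matrix.diagonal fun k : TriRegion m =>
      (∑ x ∈ Finset.range m, sineMode m k.1.1 x * sineMode m k.1.1 x) *
        ∑ x ∈ Finset.range m, sineMode m k.1.2 x * sineMode m k.1.2 x := by
  ext k l
  have hsum : ((triModeMatrix m).transpose * triModeMatrix m) k l =
      ∑ p : TriRegion m, triMode m k.1 p.1 * triMode m l.1 p.1 := rfl
  rw [hsum, sum_triRegion (f := fun p => triMode m k.1 p * triMode m l.1 p)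
    fun x => by simp [triMode, sineMode_zero]]
  simp only [triMode]
  rw [sum_range_sum_range_minor_mul_minor (fun x => sineMode m k.1.1 x)
    (fun x => sineMode m k.1.2 x) (fun x => sineMode m l.1.1 x) (fun x => sineMode m l.1.2 x)]
  have hcross : (∑ x ∈ Finset.range m, sineMode m k.1.1 x * sineMode m l.1.2 x) *
      (∑ x ∈ Finset.range m, sineMode m k.1.2 x * sineMode m l.1.1 x) = 0 := by
    by_cases h : k.1.1 = l.1.2
    · have h' : k.1.2 ≠ l.1.1 := by have := k.2; have := l.2; omega
      rw [sum_sineMode_mul_sineMode_of_ne k.snd_mem_Ioo l.fst_mem_Ioo h', mul_zero]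
    · rw [sum_sineMode_mul_sineMode_of_ne k.fst_mem_Ioo l.snd_mem_Ioo h, zero_mul]
  rw [hcross, sub_zero]
  obtain rfl | hkl := eq_or_ne k l
  · rw [Matrix.diagonal_apply_eq]
  · rw [Matrix.diagonal_apply_ne _ hkl]
    by_cases h : k.1.1 = l.1.1
    · have h' : k.1.2 ≠ l.1.2 := fun h' => hkl (Subtype.ext (Prod.ext h h'))
      rw [sum_sineMode_mul_sineMode_of_ne k.snd_mem_Ioo l.snd_mem_Ioo h', mul_zero]
    · rw [sum_sineMode_mul_sineMode_of_ne k.fst_mem_Ioo l.fst_mem_Ioo h, zero_mul]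

theorem det_triModeMatrix_ne_zero {m : ℕ} (hm : 1 < m) : (triModeMatrix m).det ≠ 0 := by
  intro h
  have hdet := congrArg Matrix.det (triModeMatrix_transpose_mul_self m)
  rw [Matrix.det_mul, h, mul_zero, Matrix.det_diagonal] at hdet
  exact (Finset.prod_pos fun k _ => mul_pos (sum_sineMode_mul_self_pos hm k.fst_mem_Ioo)
    (sum_sineMode_mul_self_pos hm k.snd_mem_Ioo)).ne hdet

theorem det_triLaplacian {m : ℕ} (hm : 1 < m) :
    (triLaplacian m).det = ∏ k : TriRegion m, triEigenvalue m k.1 := by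
  have hdet := congrArg Matrix.det (triLaplacian_mul_triModeMatrix m)
  rw [Matrix.det_mul, Matrix.det_mul, Matrix.det_diagonal, mul_comm] at hdet
  exact mul_left_cancel₀ (det_triModeMatrix_ne_zero hm) hdet

theorem prod_triEigenvalue (m : ℕ) :
    ∏ k : TriRegion m, triEigenvalue m k.1 =
      ∏ jk ∈ (Finset.Ioo 0 m ×ˢ Finset.Ioo 0 m).filter (fun jk => jk.1 < jk.2),
        (4 - 2 * cos (π * jk.1 / m) - 2 * cos (π * jk.2 / m)) := by
  refine Finset.prod_bij (fun k _ => (k.1.2.toNat, k.1.1.toNat)) ?_ ?_ ?_ ?_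
  · rintro ⟨⟨x, y⟩, hp⟩ -
    simp only [Finset.mem_filter, Finset.mem_product, Finset.mem_Ioo]
    dsimp only at hp
    omega
  · rintro ⟨⟨x, y⟩, hp⟩ - ⟨⟨x', y'⟩, hp'⟩ - h
    simp only [Prod.mk.injEq] at h
    simp only [Subtype.mk.injEq, Prod.mk.injEq]
    dsimp only at hp hp'
    omega
  · rintro ⟨j, k⟩ hjk
    simp only [Finset.mem_filter, Finset.mem_product, Finset.mem_Ioo] at hjk
    exact ⟨⟨((k : ℤ), (j : ℤ)), by dsimp only; omega⟩, Finset.mem_univ _, by simp⟩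
  · rintro ⟨⟨x, y⟩, hp⟩ -
    dsimp only at hp
    lift x to ℕ using by omega
    lift y to ℕ using by omega
    simp [triEigenvalue]

end Triangle

/-- Consider the triangular grid region
`{(x,y) ∈ ℤ² : 0 < y < x < m}` with wired (Dirichlet) boundary: each interior
point has an edge to each of its four lattice neighbours, neighbours outside the
region all being identified with a single root (so this is the graph whose
Laplacian is the negative Laplacian of `ℤ²` restricted to the region).  Spanning
trees rooted at the wired boundary are exactly the parent functions
`par : region → ℤ²` sending each point to one of its four lattice neighbours with
no directed cycle inside the region.  Their number equals
`∏_{0<j<k<m} [4 - 2cos(πj/m) - 2cos(πk/m)]`. -/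
theorem stmt12 (m : ℕ) (hm : 1 < m) :
    (Nat.card {par : {p : ℤ × ℤ // 0 < p.2 ∧ p.2 < p.1 ∧ p.1 < m} → ℤ × ℤ //
        (∀ p, |p.1.1 - (par p).1| + |p.1.2 - (par p).2| = 1) ∧
        ∀ p, ¬ Relation.TransGen
          (fun a b : {p : ℤ × ℤ // 0 < p.2 ∧ p.2 < p.1 ∧ p.1 < m} => par a = b.1)
          p p} : ℝ)
      = ∏ jk ∈ (Finset.Ioo 0 m ×ˢ Finset.Ioo 0 m).filter (fun jk => jk.1 < jk.2),
          (4 - 2 * Real.cos (Real.pi * jk.1 / m)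
             - 2 * Real.cos (Real.pi * jk.2 / m)) := by
  rw [← prod_triEigenvalue, ← det_triLaplacian hm]
  have htree := natCard_acyclic_eq_det (R := ℝ) (ι := fun p : TriRegion m => p.1)
    Subtype.val_injective fun p => latticeNeighbors p.1
  simp only [mem_latticeNeighbors] at htree
  exact htree
end
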